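/- arXiv:2605.20283 — 4 statements merged into one kernel-verified Lean document; each statement's English description precedes it below -/
import Mathlib

section
/- Let ξ > 0 and let n ≥ 2 and t₁ < t₂ < ⋯ < tₙ be real numbers. Define the n×n tridiagonal matrix R̃ by: R̃₁,₁ = (A^{[1]}_{t₁,t₂})′(t₁), R̃₁,₂ = (B^{[1]}_{t₁,t₂})′(t₁); for 2 ≤ j ≤ n−1: R̃_{j,j−1} = (A^{[1]}_{t_{j−1},t_j})′(t_j), R̃_{j,j} = (B^{[1]}_{t_{j−1},t_j})′(t_j) − (A^{[1]}_{t_j,t_{j+1}})′(t_j), R̃_{j,j+1} = −(B^{[1]}_{t_j,t_{j+1}})′(t_j); R̃_{n,n−1} = (A^{[1]}_{t_{n−1},t_n})′(t_n), R̃_{n,n} = (B^{[1]}_{t_{n−1},t_n})′(t_n); all other entries are zero. Then R̃ is strictly row diagonally dominant, i.e. |R̃_{j,j}| > Σ_{k ≠ j} |R̃_{j,k}| for every j = 1, …, n, and consequently R̃ is invertible. -/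
/-- `Φ_ξ(t) = (ξ t cosh(ξ t) − sinh(ξ t)) / (2 ξ³)`. -/
noncomputable def Phi (ξ t : ℝ) : ℝ :=
  (ξ * t * Real.cosh (ξ * t) - Real.sinh (ξ * t)) / (2 * ξ ^ 3)

/-- `ψ_ξ(t) = sinh(ξ t) / ξ`. -/
noncomputable def psi (ξ t : ℝ) : ℝ := Real.sinh (ξ * t) / ξ

/-- `A^{[2]}_{a,b}(t) = sinh(ξ(t−b)) / sinh(ξ(a−b))`. -/
noncomputable def A2 (ξ a b t : ℝ) : ℝ :=
  Real.sinh (ξ * (t - b)) / Real.sinh (ξ * (a - b))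

/-- `B^{[2]}_{a,b}(t) = sinh(ξ(t−a)) / sinh(ξ(b−a))`. -/
noncomputable def B2 (ξ a b t : ℝ) : ℝ :=
  Real.sinh (ξ * (t - a)) / Real.sinh (ξ * (b - a))

/-- `A^{[1]}_{a,b}(t) = Φ_ξ(t−b)/ψ_ξ(a−b) − A^{[2]}_{a,b}(t)·Φ_ξ(a−b)/ψ_ξ(a−b)`. -/
noncomputable def A1 (ξ a b t : ℝ) : ℝ :=
  Phi ξ (t - b) / psi ξ (a - b) - A2 ξ a b t * (Phi ξ (a - b) / psi ξ (a - b))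

/-- `B^{[1]}_{a,b}(t) = Φ_ξ(t−a)/ψ_ξ(b−a) − (Φ_ξ(b−a)/ψ_ξ(b−a))·B^{[2]}_{a,b}(t)`. -/
noncomputable def B1 (ξ a b t : ℝ) : ℝ :=
  Phi ξ (t - a) / psi ξ (b - a) - Phi ξ (b - a) / psi ξ (b - a) * B2 ξ a b t

/-- `ρ(t) = (sinh(2ξt) − 2ξt) / (4ξ sinh²(ξt))`. -/
noncomputable def rho (ξ t : ℝ) : ℝ :=
  (Real.sinh (2 * ξ * t) - 2 * ξ * t) / (4 * ξ * Real.sinh (ξ * t) ^ 2)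

/-- `σ(t) = (ξ t cosh(ξ t) − sinh(ξ t)) / (2ξ sinh²(ξt))`. -/
noncomputable def sigma (ξ t : ℝ) : ℝ :=
  (ξ * t * Real.cosh (ξ * t) - Real.sinh (ξ * t)) / (2 * ξ * Real.sinh (ξ * t) ^ 2)

theorem hasDerivAt_sinh_mul_sub (ξ c t : ℝ) :
    HasDerivAt (fun s => Real.sinh (ξ * (s - c))) (ξ * Real.cosh (ξ * (t - c))) t := by
  have h : HasDerivAt (fun s => ξ * (s - c)) ξ t := by
    simpa using ((hasDerivAt_id t).sub_const c).const_mul ξ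
  simpa [mul_comm] using h.sinh

theorem hasDerivAt_Phi_sub {ξ : ℝ} (hξ : ξ ≠ 0) (c t : ℝ) :
    HasDerivAt (fun s => Phi ξ (s - c)) ((t - c) * Real.sinh (ξ * (t - c)) / (2 * ξ)) t := by
  have h : HasDerivAt (fun s => ξ * (s - c)) ξ t := by
    simpa using ((hasDerivAt_id t).sub_const c).const_mul ξ
  refine (((h.mul h.cosh).sub h.sinh).div_const (2 * ξ ^ 3)).congr_deriv ?_
  field_simp
  ring

theorem deriv_B1 {ξ : ℝ} (hξ : ξ ≠ 0) (a b t : ℝ) :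
    deriv (B1 ξ a b) t = (t - a) * Real.sinh (ξ * (t - a)) / (2 * ξ) / psi ξ (b - a) -
      Phi ξ (b - a) / psi ξ (b - a) *
        (ξ * Real.cosh (ξ * (t - a)) / Real.sinh (ξ * (b - a))) :=
  (((hasDerivAt_Phi_sub hξ a t).div_const _).sub
    (((hasDerivAt_sinh_mul_sub ξ a t).div_const _).const_mul _)).deriv

theorem deriv_B1_right {ξ a b : ℝ} (hξ : ξ ≠ 0) (hab : a ≠ b) :
    deriv (B1 ξ a b) b = rho ξ (b - a) := by
  have hs : Real.sinh (ξ * (b - a)) ≠ 0 :=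
    Real.sinh_eq_zero.not.mpr (mul_ne_zero hξ (sub_ne_zero.mpr hab.symm))
  rw [deriv_B1 hξ, rho, Phi, psi, mul_assoc 2 ξ, Real.sinh_two_mul]
  field_simp
  rw [Real.sinh_sq]
  ring

theorem deriv_B1_left {ξ a b : ℝ} (hξ : ξ ≠ 0) (hab : a ≠ b) :
    deriv (B1 ξ a b) a = -sigma ξ (b - a) := by
  have hs : Real.sinh (ξ * (b - a)) ≠ 0 :=
    Real.sinh_eq_zero.not.mpr (mul_ne_zero hξ (sub_ne_zero.mpr hab.symm))
  rw [deriv_B1 hξ, sigma, Phi, psi]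
  simp only [sub_self, mul_zero, Real.cosh_zero, zero_mul, zero_div, zero_sub]
  field_simp

theorem A1_eq_B1 (ξ a b : ℝ) : A1 ξ a b = B1 ξ b a := by
  ext t
  simp only [A1, B1, A2, B2, mul_comm]

theorem rho_neg (ξ t : ℝ) : rho ξ (-t) = -rho ξ t := by
  simp only [rho, mul_neg, Real.sinh_neg, neg_sq]
  ring

theorem sigma_neg (ξ t : ℝ) : sigma ξ (-t) = -sigma ξ t := by
  simp only [sigma, mul_neg, Real.sinh_neg, Real.cosh_neg, neg_sq]
  ring

theorem deriv_A1_left {ξ a b : ℝ} (hξ : ξ ≠ 0) (hab : a ≠ b) :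
    deriv (A1 ξ a b) a = -rho ξ (b - a) := by
  rw [A1_eq_B1, deriv_B1_right hξ hab.symm, ← neg_sub b a, rho_neg]

theorem deriv_A1_right {ξ a b : ℝ} (hξ : ξ ≠ 0) (hab : a ≠ b) :
    deriv (A1 ξ a b) b = sigma ξ (b - a) := by
  rw [A1_eq_B1, deriv_B1_left hξ hab.symm, ← neg_sub b a, sigma_neg, neg_neg]

theorem abs_sigma_lt_rho {ξ t : ℝ} (hξ : 0 < ξ) (ht : 0 < t) : |sigma ξ t| < rho ξ t := by
  have hx : 0 < ξ * t := mul_pos hξ ht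
  have hS : ξ * t < Real.sinh (ξ * t) := Real.self_lt_sinh_iff.mpr hx
  have hC : 1 < Real.cosh (ξ * t) := Real.one_lt_cosh.mpr hx.ne'
  have hS0 : 0 < Real.sinh (ξ * t) := hx.trans hS
  have hpos : 0 < 2 * ξ * Real.sinh (ξ * t) ^ 2 := by positivity
  have hrho : rho ξ t = (Real.sinh (ξ * t) * Real.cosh (ξ * t) - ξ * t) /
      (2 * ξ * Real.sinh (ξ * t) ^ 2) := by
    rw [rho, mul_assoc 2 ξ, Real.sinh_two_mul]
    field_simp
    ring
  rw [hrho, sigma, abs_div, abs_of_pos hpos]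
  gcongr
  rw [abs_lt]
  constructor <;> nlinarith

/-- The tridiagonal matrix `R̃` of the clamped `L`-spline interpolation system is
strictly row diagonally dominant, and consequently invertible. -/
theorem clamped_matrix_diag_dominant (ξ : ℝ) (hξ : 0 < ξ) (n : ℕ) (hn : 2 ≤ n)
    (t : Fin n → ℝ) (ht : StrictMono t) (R : Matrix (Fin n) (Fin n) ℝ)
    (hR11 : R ⟨0, by omega⟩ ⟨0, by omega⟩ =
      deriv (A1 ξ (t ⟨0, by omega⟩) (t ⟨1, by omega⟩)) (t ⟨0, by omega⟩))
    (hR12 : R ⟨0, by omega⟩ ⟨1, by omega⟩ =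
      deriv (B1 ξ (t ⟨0, by omega⟩) (t ⟨1, by omega⟩)) (t ⟨0, by omega⟩))
    (hsub : ∀ (j : ℕ) (h1 : 1 ≤ j) (h2 : j ≤ n - 2),
      R ⟨j, by omega⟩ ⟨j - 1, by omega⟩ =
        deriv (A1 ξ (t ⟨j - 1, by omega⟩) (t ⟨j, by omega⟩)) (t ⟨j, by omega⟩))
    (hdiag : ∀ (j : ℕ) (h1 : 1 ≤ j) (h2 : j ≤ n - 2),
      R ⟨j, by omega⟩ ⟨j, by omega⟩ =
        deriv (B1 ξ (t ⟨j - 1, by omega⟩) (t ⟨j, by omega⟩)) (t ⟨j, by omega⟩)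
          - deriv (A1 ξ (t ⟨j, by omega⟩) (t ⟨j + 1, by omega⟩)) (t ⟨j, by omega⟩))
    (hsup : ∀ (j : ℕ) (h1 : 1 ≤ j) (h2 : j ≤ n - 2),
      R ⟨j, by omega⟩ ⟨j + 1, by omega⟩ =
        -deriv (B1 ξ (t ⟨j, by omega⟩) (t ⟨j + 1, by omega⟩)) (t ⟨j, by omega⟩))
    (hRn1 : R ⟨n - 1, by omega⟩ ⟨n - 2, by omega⟩ =
      deriv (A1 ξ (t ⟨n - 2, by omega⟩) (t ⟨n - 1, by omega⟩)) (t ⟨n - 1, by omega⟩))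
    (hRnn : R ⟨n - 1, by omega⟩ ⟨n - 1, by omega⟩ =
      deriv (B1 ξ (t ⟨n - 2, by omega⟩) (t ⟨n - 1, by omega⟩)) (t ⟨n - 1, by omega⟩))
    (hzero : ∀ i j : Fin n,
      ¬((j : ℕ) = (i : ℕ) ∨ (j : ℕ) + 1 = (i : ℕ) ∨ (i : ℕ) + 1 = (j : ℕ)) →
        R i j = 0) :
    (∀ i : Fin n, ∑ k ∈ Finset.univ.erase i, |R i k| < |R i i|) ∧ IsUnit R := by
  have hξ0 : ξ ≠ 0 := hξ.ne'
  have hne {i j : Fin n} (h : i < j) : t i ≠ t j := (ht h).ne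
  have hlt {i j : Fin n} (h : i < j) : |sigma ξ (t j - t i)| < rho ξ (t j - t i) :=
    abs_sigma_lt_rho hξ (sub_pos.mpr (ht h))
  have hdom : ∀ i : Fin n, ∑ k ∈ Finset.univ.erase i, |R i k| < |R i i| := by
    rintro ⟨j, hj⟩
    rcases Nat.eq_zero_or_pos j with rfl | hj0
    · have h01 : (⟨0, by omega⟩ : Fin n) < ⟨1, by omega⟩ := Nat.zero_lt_one
      rw [Finset.sum_eq_single_of_mem ⟨1, by omega⟩
        (Finset.mem_erase_of_ne_of_mem h01.ne' (Finset.mem_univ _))]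
      · rw [hR11, hR12, deriv_A1_left hξ0 (hne h01), deriv_B1_left hξ0 (hne h01), abs_neg, abs_neg]
        exact (hlt h01).trans_le (le_abs_self _)
      · rintro ⟨k, hk⟩ hk0 hk1
        simp only [Finset.mem_erase, ne_eq, Fin.mk.injEq] at hk0 hk1
        rw [hzero _ _ (by simp only; omega), abs_zero]
    · rcases Nat.lt_or_ge (n - 2) j with hjn | hjn
      · obtain rfl : j = n - 1 := by omega
        have hnn : (⟨n - 2, by omega⟩ : Fin n) < ⟨n - 1, hj⟩ := by
          rw [Fin.mk_lt_mk]
          omega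
        rw [Finset.sum_eq_single_of_mem ⟨n - 2, by omega⟩
          (Finset.mem_erase_of_ne_of_mem hnn.ne (Finset.mem_univ _))]
        · rw [hRn1, hRnn, deriv_A1_right hξ0 (hne hnn), deriv_B1_right hξ0 (hne hnn)]
          exact (hlt hnn).trans_le (le_abs_self _)
        · rintro ⟨k, hk⟩ hk0 hk1
          simp only [Finset.mem_erase, ne_eq, Fin.mk.injEq] at hk0 hk1
          rw [hzero _ _ (by simp only; omega), abs_zero]
      · have hl : (⟨j - 1, by omega⟩ : Fin n) < ⟨j, hj⟩ := by
          rw [Fin.mk_lt_mk]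
          omega
        have hr : (⟨j, hj⟩ : Fin n) < ⟨j + 1, by omega⟩ := Nat.lt_succ_self j
        rw [Finset.sum_eq_add_of_mem ⟨j - 1, by omega⟩ ⟨j + 1, by omega⟩
          (Finset.mem_erase_of_ne_of_mem hl.ne (Finset.mem_univ _))
          (Finset.mem_erase_of_ne_of_mem hr.ne' (Finset.mem_univ _)) (hl.trans hr).ne]
        · rw [hsub j hj0 hjn, hdiag j hj0 hjn, hsup j hj0 hjn, deriv_A1_right hξ0 (hne hl),
            deriv_B1_right hξ0 (hne hl), deriv_A1_left hξ0 (hne hr), deriv_B1_left hξ0 (hne hr),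
            neg_neg, sub_neg_eq_add]
          exact (add_lt_add (hlt hl) (hlt hr)).trans_le (le_abs_self _)
        · rintro ⟨k, hk⟩ hk0 hk1
          simp only [Finset.mem_erase, ne_eq, Fin.mk.injEq] at hk0 hk1
          rw [hzero _ _ (by simp only; omega), abs_zero]
  refine ⟨hdom, ?_⟩
  rw [Matrix.isUnit_iff_isUnit_det, isUnit_iff_ne_zero]
  exact det_ne_zero_of_sum_row_lt_diag hdom
end

section
/- For every real x > 0 and ξ > 0, one has σ(x) < ρ(x)/2, i.e. (ξ x cosh(ξ x) − sinh(ξ x))/(2 ξ sinh²(ξ x)) < (1/2)·(sinh(2 ξ x) − 2 ξ x)/(4 ξ sinh²(ξ x)). -/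
/-- For `u > 0`, `u (2 cosh u + 1) < sinh u (cosh u + 2)`. -/
theorem mul_two_cosh_add_one_lt {u : ℝ} (hu : 0 < u) :
    u * (2 * Real.cosh u + 1) < Real.sinh u * (Real.cosh u + 2) := by
  have hpos (t : ℝ) : 0 < 2 * Real.cosh t + 1 := by
    linarith [Real.cosh_pos t]
  have hderiv (t : ℝ) : HasDerivAt
      (fun t ↦ Real.sinh t * (Real.cosh t + 2) / (2 * Real.cosh t + 1) - t)
      (2 * (Real.cosh t - 1) ^ 2 * (Real.cosh t + 1) / (2 * Real.cosh t + 1) ^ 2) t := by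
    refine ((((Real.hasDerivAt_sinh t).mul ((Real.hasDerivAt_cosh t).add_const 2)).div
      (((Real.hasDerivAt_cosh t).const_mul 2).add_const 1) (hpos t).ne').sub
      (hasDerivAt_id t)).congr_deriv ?_
    have h := (hpos t).ne'
    simp only [Pi.mul_apply]
    field_simp
    linear_combination -3 * Real.sinh_sq t
  have hmono : StrictMonoOn
      (fun t ↦ Real.sinh t * (Real.cosh t + 2) / (2 * Real.cosh t + 1) - t) (Set.Ici 0) := by
    refine strictMonoOn_of_deriv_pos (convex_Ici 0)
      (fun t _ ↦ (hderiv t).continuousAt.continuousWithinAt) fun t ht ↦ ?_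
    rw [interior_Ici, Set.mem_Ioi] at ht
    rw [(hderiv t).deriv]
    have hc : 0 < Real.cosh t - 1 := sub_pos.2 (Real.one_lt_cosh.2 ht.ne')
    have := hpos t
    have := Real.cosh_pos t
    positivity
  have h := hmono Set.self_mem_Ici hu.le hu
  simp only [Real.sinh_zero, zero_mul, zero_div, sub_zero, sub_pos] at h
  exact (lt_div_iff₀ (hpos u)).1 h

/-- For every real `x > 0` and `ξ > 0`, one has `σ(x) < ρ(x)/2`. -/
theorem sigma_lt_half_rho (ξ x : ℝ) (hξ : 0 < ξ) (hx : 0 < x) :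
    sigma ξ x < rho ξ x / 2 := by
  have hu : 0 < ξ * x := mul_pos hξ hx
  have hs : 0 < Real.sinh (ξ * x) := Real.sinh_pos_iff.2 hu
  have h := mul_two_cosh_add_one_lt hu
  rw [sigma, rho, div_div, mul_assoc 2 ξ x, Real.sinh_two_mul,
    div_lt_div_iff₀ (by positivity) (by positivity)]
  have hk : 0 < 4 * ξ * Real.sinh (ξ * x) ^ 2 := by positivity
  linear_combination mul_pos hk (sub_pos.2 h)
end

section
/- For all real h₁ > 0, h₂ > 0 and ξ > 0, one has σ(h₁) + σ(h₂) < ρ(h₁) + ρ(h₂). (This expresses strict diagonal dominance of the interior rows of the clamped spline system matrix.) -/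
theorem sigma_lt_rho {ξ t : ℝ} (hξ : 0 < ξ) (ht : 0 < t) : sigma ξ t < rho ξ t := by
  have hsinh : ξ * t < Real.sinh (ξ * t) := Real.self_lt_sinh_iff.2 (mul_pos hξ ht)
  have hpos : 0 < Real.sinh (ξ * t) := Real.sinh_pos_iff.2 (mul_pos hξ ht)
  have hrho : rho ξ t = (Real.sinh (ξ * t) * Real.cosh (ξ * t) - ξ * t) /
      (2 * ξ * Real.sinh (ξ * t) ^ 2) := by
    rw [rho, mul_assoc 2 ξ t, Real.sinh_two_mul]
    field_simp
    ring
  rw [hrho, sigma]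
  gcongr ?_ / _
  nlinarith [mul_pos (sub_pos.2 hsinh) (Real.cosh_pos (ξ * t))]

/-- For all real `h₁ > 0`, `h₂ > 0` and `ξ > 0`,
`σ(h₁) + σ(h₂) < ρ(h₁) + ρ(h₂)`. -/
theorem sigma_add_sigma_lt_rho_add_rho (ξ h₁ h₂ : ℝ) (hξ : 0 < ξ)
    (h1 : 0 < h₁) (h2 : 0 < h₂) :
    sigma ξ h₁ + sigma ξ h₂ < rho ξ h₁ + rho ξ h₂ := by
  exact add_lt_add (sigma_lt_rho hξ h1) (sigma_lt_rho hξ h2)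
end

section
/- Let ξ > 0 and a < b be real numbers, and let w : ℝ → ℝ be four times continuously differentiable on a neighborhood of [a, b] and satisfy w⁗(t) − 2ξ² w″(t) + ξ⁴ w(t) = 0 for all t ∈ [a, b], together with the homogeneous boundary conditions w(a) = w(b) = 0 and w″(a) − ξ² w(a) = w″(b) − ξ² w(b) = 0. Then w(t) = 0 for all t ∈ [a, b]. -/
/-- A solution of `v″ = c v` with `0 ≤ c` on `[a, b]` that vanishes at both endpoints is zero:
`v v'` is monotone and vanishes at both endpoints, so `v ^ 2` is constant. -/
theorem eq_zero_of_hasDerivAt_of_boundary_eq_zero {a b c : ℝ} (hc : 0 ≤ c) {v v' : ℝ → ℝ}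
    (hv : ∀ t ∈ Set.Icc a b, HasDerivAt v (v' t) t)
    (hv' : ∀ t ∈ Set.Icc a b, HasDerivAt v' (c * v t) t)
    (ha : v a = 0) (hb : v b = 0) : ∀ t ∈ Set.Icc a b, v t = 0 := by
  intro t ht
  have hprod : ∀ s ∈ Set.Icc a b,
      HasDerivAt (fun x => v x * v' x) (v' s * v' s + v s * (c * v s)) s :=
    fun s hs => (hv s hs).mul (hv' s hs)
  have hmono : MonotoneOn (fun x => v x * v' x) (Set.Icc a b) := by
    refine monotoneOn_of_hasDerivWithinAt_nonneg (convex_Icc a b)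
      (fun s hs => (hprod s hs).continuousAt.continuousWithinAt)
      (fun s hs => (hprod s (interior_subset hs)).hasDerivWithinAt) fun s _ => ?_
    nlinarith [mul_self_nonneg (v' s), mul_nonneg hc (mul_self_nonneg (v s))]
  have hzero : ∀ s ∈ Set.Icc a b, v s * v' s = 0 := by
    intro s hs
    have hab := hs.1.trans hs.2
    have h₁ := hmono (Set.left_mem_Icc.2 hab) hs hs.1
    have h₂ := hmono hs (Set.right_mem_Icc.2 hab) hs.2
    simp only [ha, hb, zero_mul] at h₁ h₂
    exact le_antisymm h₂ h₁
  have hsq : ∀ s ∈ Set.Icc a b, HasDerivAt (fun x => v x * v x) 0 s := by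
    intro s hs
    exact ((hv s hs).mul (hv s hs)).congr_deriv (by linarith [hzero s hs])
  have hconst := constant_of_has_deriv_right_zero
    (fun s hs => (hsq s hs).continuousAt.continuousWithinAt)
    (fun s hs => (hsq s (Set.Ico_subset_Icc_self hs)).hasDerivWithinAt) t ht
  simpa [ha] using hconst

/-- The iterated derivatives of a `C^n` function of order less than `n` are differentiable. -/
theorem ContDiffAt.hasDerivAt_iterate_deriv {f : ℝ → ℝ} {t : ℝ} {n k : ℕ}
    (hf : ContDiffAt ℝ n f t) (hk : k < n) :
    HasDerivAt (deriv^[k] f) (deriv^[k + 1] f t) t := by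
  induction k generalizing f n with
  | zero =>
    exact (hf.differentiableAt (by exact_mod_cast hk.ne')).hasDerivAt
  | succ k ih =>
    obtain ⟨m, rfl⟩ := Nat.exists_eq_add_of_lt hk
    exact ih (n := k + 1 + m) (hf.derivWithin (by norm_cast)) (by lia)

/-- Uniqueness: a four times continuously differentiable solution of `L_ξ² w = 0` on a
neighborhood of `[a, b]` with `w(a) = w(b) = 0` and `L_ξ w(a) = L_ξ w(b) = 0` vanishes
identically on `[a, b]`. -/
theorem spline_uniqueness (ξ a b : ℝ) (hξ : 0 < ξ) (hab : a < b) (w : ℝ → ℝ)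
    (U : Set ℝ) (hU : IsOpen U) (hUab : Set.Icc a b ⊆ U) (hw : ContDiffOn ℝ 4 w U)
    (hode : ∀ t ∈ Set.Icc a b,
      deriv^[4] w t - 2 * ξ ^ 2 * deriv^[2] w t + ξ ^ 4 * w t = 0)
    (ha : w a = 0) (hb : w b = 0)
    (hLa : deriv^[2] w a - ξ ^ 2 * w a = 0) (hLb : deriv^[2] w b - ξ ^ 2 * w b = 0) :
    ∀ t ∈ Set.Icc a b, w t = 0 := by
  have hderiv : ∀ k < 4, ∀ t ∈ Set.Icc a b, HasDerivAt (deriv^[k] w) (deriv^[k + 1] w t) t :=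
    fun k hk t ht =>
      ContDiffAt.hasDerivAt_iterate_deriv (n := 4) (hw.contDiffAt (hU.mem_nhds (hUab ht))) hk
  have hL : ∀ t ∈ Set.Icc a b, deriv^[2] w t - ξ ^ 2 * w t = 0 := by
    refine eq_zero_of_hasDerivAt_of_boundary_eq_zero (sq_nonneg ξ)
      (v' := fun t => deriv^[3] w t - ξ ^ 2 * deriv^[1] w t) (fun t ht => ?_) (fun t ht => ?_)
      hLa hLb
    · exact (hderiv 2 (by norm_num) t ht).sub ((hderiv 0 (by norm_num) t ht).const_mul _)
    · refine ((hderiv 3 (by norm_num) t ht).sub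
        ((hderiv 1 (by norm_num) t ht).const_mul (ξ ^ 2))).congr_deriv ?_
      linear_combination hode t ht
  refine eq_zero_of_hasDerivAt_of_boundary_eq_zero (sq_nonneg ξ) (v' := deriv^[1] w)
    (hderiv 0 (by norm_num)) (fun t ht => ?_) ha hb
  rw [← sub_eq_zero.1 (hL t ht)]
  exact hderiv 1 (by norm_num) t ht
end
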